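/- Let $\mathit{\Gamma}$ be a connected digraph, let $H$ be a finite group acting on $\mathit{\Gamma}$ by automorphisms, and suppose $\mathit{\Gamma}$ is $H$-vertex-transitive, $H$-arc-transitive, and $(H,s)$-arc-transitive with $s \geq 2$. Let $u \to v \to v_1$ be a $2$-arc of $\mathit{\Gamma}$. Suppose $M_1$ and $M_2$ are quasisimple subgroups of $H_v$ that commute elementwise, such that $M_1 M_2$ is the smallest normal subgroup $K$ of $H_v$ with $H_v/K$ solvable (i.e., $M_1M_2 = H_v^{(\infty)}$), and such that $M_1/\mathrm{Z}(M_1)$ has no section isomorphic to $N_2 := M_2/\mathrm{Z}(M_2)$. Let $N$ be a normal subgroup of $H_v$ such that $H_v/N$ has a normal subgroup $S$ isomorphic to $N_2$ with trivial centralizer $C_{H_v/N}(S)=1$ (that is, $H_v/N$ is almost simple with socle $N_2$). Then in the factorisation $H_v/N = (H_{uv}N/N)(H_{vv_1}N/N)$, both factors $H_{uv}N/N$ and $H_{vv_1}N/N$ are core-free in $H_v/N$, i.e., their normal cores in $H_v/N$ are trivial. -/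

import Mathlib

/-- `Γ` is `(H,s)`-arc-transitive: `H` is transitive on the set of `s`-arcs. -/
def ArcTrans (H : Type*) {V : Type*} [Group H] [MulAction H V]
    (r : V → V → Prop) (s : ℕ) : Prop :=
  ∀ a b : Fin (s + 1) → V, (∀ i : Fin s, r (a i.castSucc) (a i.succ)) →
    (∀ i : Fin s, r (b i.castSucc) (b i.succ)) → ∃ h : H, ∀ i, h • a i = b i

/-- A finite group is quasisimple if it is perfect and its central quotient is
nonabelian simple. -/
def IsQuasisimple (G : Type*) [Group G] : Prop :=
  commutator G = ⊤ ∧ IsSimpleGroup (G ⧸ Subgroup.center G) ∧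
    ∃ a b : G ⧸ Subgroup.center G, a * b ≠ b * a

/-- `G` has a section (a quotient `K/K'` with `K' ⊴ K ≤ G`) isomorphic to `T`;
equivalently, some subgroup of `G` has a surjective homomorphism onto `T`. -/
def HasSectionIsoTo (G T : Type*) [Group G] [Group T] : Prop :=
  ∃ (K : Subgroup G) (f : K →* T), Function.Surjective f

section GroupLemmas

open Subgroup
open scoped commutatorElement

variable {X Q T : Type*} [Group X] [Group Q] [Group T]

/-- A surjection whose kernel contains the kernel of `p` descends to the range of `p`. -/
theorem exists_surjective_of_range_of_ker_le (f : X →* T) (hf : Function.Surjective f)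
    (p : X →* Q) (hp : p.ker ≤ f.ker) : ∃ g : p.range →* T, Function.Surjective g := by
  refine ⟨p.rangeRestrict.liftOfSurjective p.rangeRestrict_surjective
    ⟨f, by rwa [MonoidHom.ker_rangeRestrict]⟩, fun t => ?_⟩
  obtain ⟨x, rfl⟩ := hf t
  exact ⟨p.rangeRestrict x, MonoidHom.liftOfRightInverse_comp_apply _ _ _ _ _⟩

/-- The image of a normal subgroup under a surjection onto a simple group is trivial or
everything. -/
theorem le_ker_or_map_eq_top_of_isSimpleGroup [IsSimpleGroup T] (f : X →* T)
    (hf : Function.Surjective f) (J : Subgroup X) [hJ : J.Normal] :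
    J ≤ f.ker ∨ J.map f = ⊤ :=
  ((hJ.map f hf).eq_bot_or_eq_top).imp_left (map_eq_bot_iff J).1

theorem center_eq_bot_of_isSimpleGroup [IsSimpleGroup T] (hT : ∃ a b : T, a * b ≠ b * a) :
    center T = ⊥ := by
  refine ((inferInstance : (center T).Normal).eq_bot_or_eq_top).resolve_right fun h => ?_
  obtain ⟨a, b, hab⟩ := hT
  exact hab (mem_center_iff.1 (h ▸ mem_top b) a)

theorem not_isSolvable_of_isSimpleGroup [IsSimpleGroup T] (hT : ∃ a b : T, a * b ≠ b * a) :
    ¬ Group.IsSolvable T := fun h => by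
  obtain ⟨a, b, hab⟩ := hT
  exact hab (IsSimpleGroup.comm_iff_isSolvable.2 h a b)

/-- A homomorphism from a perfect group to a solvable group is trivial. -/
theorem ker_eq_top_of_commutator_eq_top [Group.IsSolvable Q] (hX : commutator X = ⊤) (f : X →* Q) :
    f.ker = ⊤ := by
  have h : ∀ n, derivedSeries X n = ⊤ := fun n => by
    induction n with
    | zero => rfl
    | succ n ih => rw [derivedSeries_succ, ih]; exact hX
  obtain ⟨n, hn⟩ := (inferInstance : Group.IsSolvable Q).solvable
  rw [← top_le_iff, ← Subgroup.map_eq_bot_iff, ← h n]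
  exact le_bot_iff.1 (hn ▸ map_derivedSeries_le_derivedSeries f n)

/-- A subgroup of `A × B` that maps onto the simple central quotient of the quasisimple group `B`
contains `1 × B`, provided that simple group is not a section of `A / Z(A)`. -/
theorem one_prod_mem_of_surjective {A B : Type*} [Group A] [Group B] [Finite B]
    (hB : IsQuasisimple B) (hsec : ¬ HasSectionIsoTo (A ⧸ center A) (B ⧸ center B))
    (L : Subgroup (A × B)) (f : L →* B ⧸ center B) (hf : Function.Surjective f) (b : B) :
    ((1, b) : A × B) ∈ L := by
  obtain ⟨hperf, hsimp, hnc⟩ := hB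
  let p : L →* A ⧸ center A :=
    (QuotientGroup.mk' (center A)).comp ((MonoidHom.fst A B).comp L.subtype)
  let q : L →* B ⧸ center B :=
    (QuotientGroup.mk' (center B)).comp ((MonoidHom.snd A B).comp L.subtype)
  have hpmem : ∀ x : L, x ∈ p.ker ↔ x.1.1 ∈ center A := fun x =>
    QuotientGroup.eq_one_iff (N := center A) x.1.1
  have hqmem : ∀ x : L, x ∈ q.ker ↔ x.1.2 ∈ center B := fun x =>
    QuotientGroup.eq_one_iff (N := center B) x.1.2
  have htop : p.ker.map f = ⊤ :=
    (le_ker_or_map_eq_top_of_isSimpleGroup f hf p.ker).resolve_left fun h =>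
      hsec ⟨p.range, exists_surjective_of_range_of_ker_le f hf p h⟩
  have hcent : p.ker ⊓ q.ker ≤ f.ker := fun x hx => by
    have hxc : f x ∈ center (B ⧸ center B) := mem_center_iff.2 fun t => by
      obtain ⟨y, rfl⟩ := hf t
      rw [← map_mul, ← map_mul]
      congr 1
      exact Subtype.ext (Prod.ext (mem_center_iff.1 ((hpmem x).1 hx.1) _)
        (mem_center_iff.1 ((hqmem x).1 hx.2) _))
    rwa [center_eq_bot_of_isSimpleGroup hnc] at hxc
  have hfJ : Function.Surjective (f.comp p.ker.subtype) := fun t => by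
    obtain ⟨x, hx, rfl⟩ := (htop ▸ mem_top t : t ∈ p.ker.map f)
    exact ⟨⟨x, hx⟩, rfl⟩
  obtain ⟨g, hg⟩ := exists_surjective_of_range_of_ker_le (f.comp p.ker.subtype) hfJ
    (q.comp p.ker.subtype) fun x hx => hcent ⟨x.2, hx⟩
  have hq : (q.comp p.ker.subtype).range = ⊤ :=
    eq_top_of_le_card _ (Nat.card_le_card_of_surjective g hg)
  have hlift : ∀ m : B, ∃ x : L, x.1.1 ∈ center A ∧ x.1.2⁻¹ * m ∈ center B := fun m => by
    obtain ⟨x, hx⟩ := (hq ▸ mem_top (m : B ⧸ center B) :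
      (m : B ⧸ center B) ∈ (q.comp p.ker.subtype).range)
    exact ⟨x, (hpmem x).1 x.2, QuotientGroup.eq.1 hx⟩
  have hle : commutator B ≤ L.comap (MonoidHom.inr A B) := by
    rw [commutator_def, commutator_le]
    intro m _ m' _
    obtain ⟨x, hx1, hx2⟩ := hlift m
    obtain ⟨y, hy1, hy2⟩ := hlift m'
    have key : MonoidHom.inr A B ⁅m, m'⁆ = ((⁅x, y⁆ : L) : A × B) := by
      obtain ⟨z, hz, rfl⟩ : ∃ z ∈ center B, m = x.1.2 * z := ⟨_, hx2, by group⟩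
      obtain ⟨w, hw, rfl⟩ : ∃ w ∈ center B, m' = y.1.2 * w := ⟨_, hy2, by group⟩
      refine Prod.ext ?_ ?_
      · simp [commutatorElement_def, (mem_center_iff.1 hx1 y.1.1).symm]
      · have hz' := mem_center_iff.1 hz
        have hw' := mem_center_iff.1 hw
        simp only [MonoidHom.inr_apply, commutatorElement_def, coe_mul, coe_inv, Prod.snd_mul,
          Prod.snd_inv, mul_inv_rev]
        calc x.1.2 * z * (y.1.2 * w) * (z⁻¹ * x.1.2⁻¹) * (w⁻¹ * y.1.2⁻¹)
            = x.1.2 * (z * (y.1.2 * w)) * z⁻¹ * x.1.2⁻¹ * w⁻¹ * y.1.2⁻¹ := by group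
          _ = x.1.2 * y.1.2 * (w * x.1.2⁻¹) * w⁻¹ * y.1.2⁻¹ := by
              rw [← hz' (y.1.2 * w)]; group
          _ = x.1.2 * y.1.2 * x.1.2⁻¹ * y.1.2⁻¹ := by rw [← hw' x.1.2⁻¹]; group
    rw [mem_comap, key]
    exact (⁅x, y⁆ : L).2
  exact hle (hperf ▸ mem_top b)

/-- If `M₁` and `M₂` commute elementwise, `M₂` is quasisimple and `M₁ / Z(M₁)` has no section
isomorphic to `M₂ / Z(M₂)`, then a subgroup of `M₁ M₂` that maps onto `M₂ / Z(M₂)` contains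
`M₂`. -/
theorem le_range_of_surjective {G : Type*} [Group G] [Finite G] {M₁ M₂ : Subgroup G}
    (hcomm : ∀ a ∈ M₁, ∀ b ∈ M₂, a * b = b * a) (hM₂ : IsQuasisimple M₂)
    (hsec : ¬ HasSectionIsoTo (M₁ ⧸ center M₁) (M₂ ⧸ center M₂))
    (i : X →* G) (hi : Function.Injective i) (hile : i.range ≤ M₁ ⊔ M₂)
    (f : X →* M₂ ⧸ center M₂) (hf : Function.Surjective f) : M₂ ≤ i.range := by
  let c : M₁ × M₂ →* G := MonoidHom.noncommCoprod M₁.subtype M₂.subtype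
    fun a b => hcomm a a.2 b b.2
  have hc : ∀ x, c x = x.1 * x.2 := fun _ => rfl
  have hcr : c.range = M₁ ⊔ M₂ := by
    simpa using MonoidHom.noncommCoprod_range M₁.subtype M₂.subtype
      fun a b => hcomm a a.2 b b.2
  let e : i.range →* X := (MonoidHom.ofInjective hi).symm.toMonoidHom
  let k : i.range.comap c →* i.range := c.subgroupComap i.range
  have hk : Function.Surjective k := fun y => by
    obtain ⟨x, hx⟩ := (hcr ▸ hile y.2 : (y : G) ∈ c.range)
    exact ⟨⟨x, show c x ∈ i.range from hx ▸ y.2⟩, Subtype.ext hx⟩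
  intro m hm
  have h := one_prod_mem_of_surjective hM₂ hsec (i.range.comap c) (f.comp (e.comp k))
    (hf.comp ((MonoidHom.ofInjective hi).symm.surjective.comp hk)) ⟨m, hm⟩
  simpa [hc, mem_comap] using h

/-- A subgroup whose normal core is nontrivial contains every simple normal subgroup with trivial
centralizer. -/
theorem le_of_normalCore_ne_bot {S R : Subgroup Q} [hS : S.Normal] [IsSimpleGroup S]
    (hcent : centralizer (S : Set Q) = ⊥) (hR : R.normalCore ≠ ⊥) : S ≤ R := by
  rcases ((inferInstance : (R.normalCore.subgroupOf S).Normal).eq_bot_or_eq_top) with h | h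
  · refine (hR (le_bot_iff.1 (hcent ▸ fun x hx => mem_centralizer_iff.2 fun y hy => ?_))).elim
    exact (commute_of_normal_of_disjoint _ _ hS inferInstance
      (subgroupOf_eq_bot.1 h).symm y x hy hx).eq
  · exact (subgroupOf_eq_top.1 h).trans R.normalCore_le

end GroupLemmas

/-- Transitivity on `s`-arcs with `2 ≤ s` implies transitivity on `2`-arcs, when every vertex has
an out-neighbour. -/
theorem ArcTrans.exists_smul_two_arc {H V : Type*} [Group H] [MulAction H V]
    {r : V → V → Prop} {s : ℕ} (hst : ArcTrans H r s) (hs : 2 ≤ s) (hout : ∀ x, ∃ y, r x y)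
    {x₀ x₁ x₂ y₀ y₁ y₂ : V} (hx₀ : r x₀ x₁) (hx₁ : r x₁ x₂) (hy₀ : r y₀ y₁) (hy₁ : r y₁ y₂) :
    ∃ h : H, h • x₀ = y₀ ∧ h • x₁ = y₁ ∧ h • x₂ = y₂ := by
  choose σ hσ using hout
  let e : V → V → V → ℕ → V := fun a b c n =>
    match n with
    | 0 => a
    | 1 => b
    | n + 2 => σ^[n] c
  have he : ∀ {a b c : V}, r a b → r b c → ∀ n, r (e a b c n) (e a b c (n + 1)) := by
    intro a b c hab hbc n
    match n with
    | 0 => exact hab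
    | 1 => exact hbc
    | n + 2 =>
      change r (σ^[n] c) (σ^[n + 1] c)
      rw [Function.iterate_succ_apply']
      exact hσ _
  obtain ⟨h, hh⟩ := hst (fun i => e x₀ x₁ x₂ i) (fun i => e y₀ y₁ y₂ i)
    (fun i => he hx₀ hx₁ i) (fun i => he hy₀ hy₁ i)
  exact ⟨h, hh ⟨0, by omega⟩, hh ⟨1, by omega⟩, hh ⟨2, by omega⟩⟩

/-- Transitivity on `1`-arcs, in terms of pairs of vertices. -/
theorem ArcTrans.exists_smul_arc {H V : Type*} [Group H] [MulAction H V]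
    {r : V → V → Prop} (hat : ArcTrans H r 1) {x₀ x₁ y₀ y₁ : V} (hx : r x₀ x₁) (hy : r y₀ y₁) :
    ∃ h : H, h • x₀ = y₀ ∧ h • x₁ = y₁ := by
  obtain ⟨h, hh⟩ := hat ![x₀, x₁] ![y₀, y₁] (by simpa using hx) (by simpa using hy)
  exact ⟨h, hh 0, hh 1⟩

/-- In a connected arc-transitive and vertex-transitive digraph, a subgroup `M` of a vertex
stabilizer is trivial if it is normalized by every element `g` such that `M` fixes `g • v`, and if
some element normalizing `M` maps `v` to an out-neighbour. -/
theorem eq_bot_of_arc_mem_normalizer {V H : Type*} [Group H] [MulAction H V] [FaithfulSMul H V]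
    {r : V → V → Prop} (hact : ∀ (h : H) (u w : V), r u w → r (h • u) (h • w))
    (hconn : (SimpleGraph.fromRel r).Connected) (hvt : ∀ u w : V, ∃ h : H, h • u = w)
    (hat : ArcTrans H r 1) {u v w : V} (huv : r u v) (hvw : r v w) {M : Subgroup H}
    (hM : M ≤ MulAction.stabilizer H v)
    (hnorm : ∀ g : H, M ≤ MulAction.stabilizer H (g • v) → g ∈ Subgroup.normalizer (M : Set H))
    {g : H} (hg : g ∈ Subgroup.normalizer (M : Set H)) (hgu : g • u = v) (hgv : g • v = w) :
    M = ⊥ := by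
  have hfix : ∀ d ∈ Subgroup.normalizer (M : Set H), M ≤ MulAction.stabilizer H (d • v) := by
    intro d hd m hm
    have h := hM ((Subgroup.mem_normalizer_iff''.1 hd m).1 hm)
    rw [MulAction.mem_stabilizer_iff] at h ⊢
    rw [mul_smul, mul_smul, inv_smul_eq_iff] at h
    exact h
  have hstab : ∀ k : H, k • v = v → k ∈ Subgroup.normalizer (M : Set H) := fun k hk =>
    hnorm k (hk.symm ▸ hM)
  have hall : ∀ x : V, M ≤ MulAction.stabilizer H x := by
    intro x
    obtain ⟨walk⟩ := hconn.preconnected v x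
    have hstep : ∀ {a b : V}, (SimpleGraph.fromRel r).Adj a b →
        M ≤ MulAction.stabilizer H a → M ≤ MulAction.stabilizer H b := by
      intro a b hab ha
      obtain ⟨d, rfl⟩ := hvt v a
      have hd := hnorm d ha
      rcases ((SimpleGraph.fromRel_adj r _ _).1 hab).2 with h | h
      · have h' := hact d⁻¹ _ _ h
        rw [inv_smul_smul] at h'
        obtain ⟨k, hk, hk'⟩ := hat.exists_smul_arc hvw h'
        have := hfix (d * k * g) (mul_mem (mul_mem hd (hstab k hk)) hg)
        rwa [mul_smul, mul_smul, hgv, hk', smul_inv_smul] at this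
      · have h' := hact d⁻¹ _ _ h
        rw [inv_smul_smul] at h'
        obtain ⟨k, hk', hk⟩ := hat.exists_smul_arc huv h'
        have := hfix (d * k * g⁻¹) (mul_mem (mul_mem hd (hstab k hk)) (inv_mem hg))
        rwa [mul_smul, mul_smul, ← hgu, inv_smul_smul, hk', smul_inv_smul] at this
    clear hfix hstab hnorm hg hgu hgv huv hvw
    induction walk with
    | nil => exact hM
    | cons hadj _ ih => exact ih (hstep hadj hM)
  refine (Subgroup.eq_bot_iff_forall M).2 fun m hm =>
    FaithfulSMul.eq_of_smul_eq_smul fun x : V => ?_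
  rw [one_smul]
  exact hall x hm

/-- Suppose `M₁ M₂` is normal in `Gv` with solvable quotient, and `S ≅ M₂ / Z(M₂)` is a subgroup
of a quotient `Gv / N`. If the image of `R ∩ Gv` in `Gv / N` contains `S`, then `R` contains
`M₂`. -/
theorem le_of_le_map_mk_subgroupOf {H : Type*} [Group H] [Finite H] {Gv R : Subgroup H}
    {M₁ M₂ : Subgroup H} (hM₂qs : IsQuasisimple M₂)
    (hcomm : ∀ a ∈ M₁, ∀ b ∈ M₂, a * b = b * a)
    (hsec : ¬ HasSectionIsoTo (M₁ ⧸ Subgroup.center M₁) (M₂ ⧸ Subgroup.center M₂))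
    [hK : ((M₁ ⊔ M₂).subgroupOf Gv).Normal]
    (hKsolv : Group.IsSolvable (Gv ⧸ (M₁ ⊔ M₂).subgroupOf Gv))
    {N : Subgroup Gv} [N.Normal] {S : Subgroup (Gv ⧸ N)}
    (φ : S ≃* (M₂ ⧸ Subgroup.center M₂))
    (hS : S ≤ (R.subgroupOf Gv).map (QuotientGroup.mk' N)) : M₂ ≤ R := by
  have hsimp := hM₂qs.2.1
  let B : Subgroup Gv := R.subgroupOf Gv ⊓ S.comap (QuotientGroup.mk' N)
  let f : B →* M₂ ⧸ Subgroup.center M₂ := φ.toMonoidHom.comp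
    (((QuotientGroup.mk' N).comp B.subtype).codRestrict S fun x => x.2.2)
  have hf : Function.Surjective f := fun t => by
    obtain ⟨x, hx, hxs⟩ := hS (φ.symm t).2
    refine ⟨⟨x, hx, show QuotientGroup.mk' N x ∈ S from hxs ▸ (φ.symm t).2⟩, ?_⟩
    exact (congrArg φ (Subtype.ext hxs)).trans (φ.apply_symm_apply t)
  let p : B →* Gv ⧸ (M₁ ⊔ M₂).subgroupOf Gv := (QuotientGroup.mk' _).comp B.subtype
  have htop : p.ker.map f = ⊤ := by
    refine (le_ker_or_map_eq_top_of_isSimpleGroup f hf p.ker).resolve_left fun h => ?_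
    obtain ⟨g, hg⟩ := exists_surjective_of_range_of_ker_le f hf p h
    exact not_isSolvable_of_isSimpleGroup hM₂qs.2.2 (Group.isSolvable_of_surjective hg)
  let i : p.ker →* H := Gv.subtype.comp (B.subtype.comp p.ker.subtype)
  have hi : Function.Injective i := Subtype.val_injective.comp
    (Subtype.val_injective.comp Subtype.val_injective)
  refine (le_range_of_surjective hcomm hM₂qs hsec i hi ?_ (f.comp p.ker.subtype) ?_).trans ?_
  · rintro _ ⟨x, rfl⟩
    exact (QuotientGroup.eq_one_iff (N := (M₁ ⊔ M₂).subgroupOf Gv) x.1.1).1 x.2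
  · intro t
    obtain ⟨x, hx, rfl⟩ := (htop ▸ Subgroup.mem_top t : t ∈ p.ker.map f)
    exact ⟨⟨x, hx⟩, rfl⟩
  · rintro _ ⟨x, rfl⟩
    exact x.1.2.1

/-- Suppose `M₁ M₂` is normal in the stabilizer of `v` with solvable quotient. If `M₂` fixes `g • v`, then
`g` normalizes `M₂`. -/
theorem mem_normalizer_of_le_stabilizer_smul {V H : Type*} [Group H] [Finite H] [MulAction H V]
    {v : V} {M₁ M₂ : Subgroup H} (hM₂qs : IsQuasisimple M₂)
    (hcomm : ∀ a ∈ M₁, ∀ b ∈ M₂, a * b = b * a)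
    (hsec : ¬ HasSectionIsoTo (M₁ ⧸ Subgroup.center M₁) (M₂ ⧸ Subgroup.center M₂))
    [hK : ((M₁ ⊔ M₂).subgroupOf (MulAction.stabilizer H v)).Normal]
    (hKsolv : Group.IsSolvable
      (MulAction.stabilizer H v ⧸ (M₁ ⊔ M₂).subgroupOf (MulAction.stabilizer H v)))
    {g : H} (hg : M₂ ≤ MulAction.stabilizer H (g • v)) :
    g ∈ Subgroup.normalizer (M₂ : Set H) := by
  let i : M₂ →* H := (MulAut.conj g⁻¹).toMonoidHom.comp M₂.subtype
  have hi : Function.Injective i := (MulAut.conj g⁻¹).injective.comp Subtype.val_injective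
  have hiv : ∀ x, i x ∈ MulAction.stabilizer H v := fun x => by
    have h := hg x.2
    rw [MulAction.mem_stabilizer_iff] at h ⊢
    simp [i, mul_smul, h]
  let p := (QuotientGroup.mk' ((M₁ ⊔ M₂).subgroupOf (MulAction.stabilizer H v))).comp
    (i.codRestrict _ hiv)
  have hp : p.ker = ⊤ := ker_eq_top_of_commutator_eq_top hM₂qs.1 p
  have hile : i.range ≤ M₁ ⊔ M₂ := by
    rintro _ ⟨x, rfl⟩
    exact (QuotientGroup.eq_one_iff (N := (M₁ ⊔ M₂).subgroupOf (MulAction.stabilizer H v))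
      (i.codRestrict _ hiv x)).1 (hp ▸ Subgroup.mem_top x : x ∈ p.ker)
  have hle := le_range_of_surjective hcomm hM₂qs hsec i hi hile (QuotientGroup.mk' _)
    (QuotientGroup.mk'_surjective _)
  have heq : M₂ = i.range := Subgroup.eq_of_le_of_card_ge hle
    (Nat.card_le_card_of_surjective i.rangeRestrict i.rangeRestrict_surjective)
  rw [← inv_mem_iff, Subgroup.mem_normalizer_iff_map_conj_eq]
  conv_rhs => rw [heq]
  rw [MonoidHom.range_comp, Subgroup.range_subtype]
  rfl

/-- Lemma on core-freeness of the two factors in the factorisation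
`H_v/N = (H_{uv}N/N)(H_{vv₁}N/N)`. -/
theorem factors_corefree_of_quasisimple_components {V H : Type*} [Fintype V]
    [Group H] [Finite H] [MulAction H V] [FaithfulSMul H V]
    (r : V → V → Prop) (hirr : Irreflexive r) (hanti : ∀ u w, r u w → ¬ r w u)
    (hact : ∀ (h : H) (u w : V), r u w → r (h • u) (h • w))
    (hconn : (SimpleGraph.fromRel r).Connected)
    (hvt : ∀ u w : V, ∃ h : H, h • u = w)
    (s : ℕ) (hs : 2 ≤ s)
    (hat : ArcTrans H r 1) (hst : ArcTrans H r s)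
    (u v v1 : V) (huv : r u v) (hvv1 : r v v1)
    (M1 M2 : Subgroup H)
    (hM1le : M1 ≤ MulAction.stabilizer H v) (hM2le : M2 ≤ MulAction.stabilizer H v)
    (hM1qs : IsQuasisimple M1) (hM2qs : IsQuasisimple M2)
    (hcomm : ∀ a ∈ M1, ∀ b ∈ M2, a * b = b * a)
    -- `M1 M2 = H_v^{(∞)}` : it is normal in `H_v`, the quotient is solvable, and it
    -- is contained in every normal subgroup of `H_v` with solvable quotient.
    (hKnormal : ((M1 ⊔ M2).subgroupOf (MulAction.stabilizer H v)).Normal)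
    (hKsolv : @IsSolvable
      (MulAction.stabilizer H v ⧸ (M1 ⊔ M2).subgroupOf (MulAction.stabilizer H v))
      (@QuotientGroup.Quotient.group _ _ _ hKnormal))
    (hKmin : ∀ (K : Subgroup (MulAction.stabilizer H v)) (hK : K.Normal),
      @IsSolvable (MulAction.stabilizer H v ⧸ K)
        (@QuotientGroup.Quotient.group _ _ K hK) →
      (M1 ⊔ M2).subgroupOf (MulAction.stabilizer H v) ≤ K)
    -- `N₁ = M1/Z(M1)` has no section isomorphic to `N₂ = M2/Z(M2)`.
    (hnosec : ¬ HasSectionIsoTo (M1 ⧸ Subgroup.center M1) (M2 ⧸ Subgroup.center M2))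
    -- `N ⊴ H_v` with `H_v/N` almost simple with socle `S ≅ N₂`.
    (N : Subgroup (MulAction.stabilizer H v)) (hN : N.Normal)
    (S : Subgroup (MulAction.stabilizer H v ⧸ N)) (hSnormal : S.Normal)
    (hSiso : Nonempty (S ≃* (M2 ⧸ Subgroup.center M2)))
    (hScent : Subgroup.centralizer (S : Set (MulAction.stabilizer H v ⧸ N)) = ⊥) :
    (∀ q : MulAction.stabilizer H v ⧸ N,
      ∃ a ∈ Subgroup.map (QuotientGroup.mk' N)
          ((MulAction.stabilizer H u ⊓ MulAction.stabilizer H v).subgroupOf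
            (MulAction.stabilizer H v)),
        ∃ b ∈ Subgroup.map (QuotientGroup.mk' N)
          ((MulAction.stabilizer H v ⊓ MulAction.stabilizer H v1).subgroupOf
            (MulAction.stabilizer H v)),
          q = a * b) ∧
    (Subgroup.map (QuotientGroup.mk' N)
        ((MulAction.stabilizer H u ⊓ MulAction.stabilizer H v).subgroupOf
          (MulAction.stabilizer H v))).normalCore = ⊥ ∧
    (Subgroup.map (QuotientGroup.mk' N)
        ((MulAction.stabilizer H v ⊓ MulAction.stabilizer H v1).subgroupOf
          (MulAction.stabilizer H v))).normalCore = ⊥ := by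
  have hout : ∀ x, ∃ y, r x y := fun x => by
    obtain ⟨h, rfl⟩ := hvt v x
    exact ⟨_, hact h _ _ hvv1⟩
  obtain ⟨φ⟩ := hSiso
  have hsimp := hM2qs.2.1
  have hSsimp : IsSimpleGroup S := φ.isSimpleGroup
  obtain ⟨g, hgu, hgv⟩ := hat.exists_smul_arc huv hvv1
  have hnorm : ∀ g : H, M2 ≤ MulAction.stabilizer H (g • v) →
      g ∈ Subgroup.normalizer (M2 : Set H) := fun g hg =>
    mem_normalizer_of_le_stabilizer_smul hM2qs hcomm hnosec hKsolv hg
  have hcover : ∀ R : Subgroup H,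
      ((R.subgroupOf (MulAction.stabilizer H v)).map (QuotientGroup.mk' N)).normalCore ≠ ⊥ →
      M2 ≤ R := fun R hR =>
    le_of_le_map_mk_subgroupOf hM2qs hcomm hnosec hKsolv φ (le_of_normalCore_ne_bot hScent hR)
  have hfalse : g ∉ Subgroup.normalizer (M2 : Set H) := fun hg => by
    have hbot := eq_bot_of_arc_mem_normalizer hact hconn hvt hat huv hvv1 hM2le hnorm hg hgu hgv
    subst hbot
    obtain ⟨a, b, hab⟩ := hM2qs.2.2
    exact hab (Subsingleton.elim _ _)
  refine ⟨fun q => ?_, ?_, ?_⟩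
  · obtain ⟨x, rfl⟩ := QuotientGroup.mk'_surjective N q
    have hx := hact x _ _ hvv1
    have hxv : (x : H) • v = v := x.2
    rw [hxv] at hx
    obtain ⟨a, hau, hav, hav1⟩ := hst.exists_smul_two_arc hs hout huv hvv1 huv hx
    let a' : MulAction.stabilizer H v := ⟨a, hav⟩
    refine ⟨QuotientGroup.mk' N a', ⟨a', ⟨hau, hav⟩, rfl⟩, QuotientGroup.mk' N (a'⁻¹ * x),
      ⟨a'⁻¹ * x, ⟨(a'⁻¹ * x).2, ?_⟩, rfl⟩, ?_⟩
    · change (a⁻¹ * (x : H)) • v1 = v1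
      rw [mul_smul, ← hav1, inv_smul_smul]
    · rw [← map_mul, mul_inv_cancel_left]
  · by_contra h
    have hu : M2 ≤ MulAction.stabilizer H (g⁻¹ • v) := by
      rw [← hgu, inv_smul_smul]
      exact (hcover _ h).trans inf_le_left
    exact hfalse (inv_mem_iff.1 (hnorm _ hu))
  · by_contra h
    exact hfalse (hnorm g (hgv ▸ (hcover _ h).trans inf_le_right))
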